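/- Let G be a connected simple graph on a vertex set V with |V| = n ≥ 1, and let v ∈ V. Let P ∈ ℚ[t] be the chromatic polynomial of G, i.e., the unique polynomial such that for every positive integer q, P(q) equals the number of proper colorings f : V → {1,…,q} of G (functions with f(i) ≠ f(j) for every edge {i,j} of G). Then the number of acyclic orientations of G whose unique sink is v equals (−1)^{n−1} times the coefficient of t¹ in P. -/

import Mathlib

/-- `IsOrientation G r`: the relation `r` chooses, for each edge `{i,j}` of `G`,
exactly one of the ordered pairs `(i,j)` or `(j,i)`. -/
def IsOrientation {V : Type} (G : SimpleGraph V) (r : V → V → Prop) : Prop :=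
  (∀ i j, (r i j ∨ r j i) ↔ G.Adj i j) ∧ ∀ i j, ¬(r i j ∧ r j i)

/-- An orientation is acyclic if the resulting directed graph has no directed cycle. -/
def IsAcyclicOrientation {V : Type} (r : V → V → Prop) : Prop :=
  ∀ w, ¬ Relation.TransGen r w w

/-- `w` is a sink of the orientation `r` if no chosen ordered pair has first
coordinate `w`. -/
def IsSink {V : Type} (r : V → V → Prop) (w : V) : Prop :=
  ∀ u, ¬ r w u

open Finset in
/-- proper colourings of `G[W]` with colours `1..q`, extended by `0` outside `W`. -/
noncomputable def gzCol {V : Type} [Fintype V] (G : SimpleGraph V) (W : Finset V) (q : ℕ) :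
    Finset (V → ℕ) := by
  classical
  exact (Fintype.piFinset fun i => if i ∈ W then Icc 1 q else {0}).filter (fun f => ∀ i ∈ W, ∀ j ∈ W, G.Adj i j → f i ≠ f j)

lemma gz_mem_col {V : Type} [Fintype V] (G : SimpleGraph V) (W : Finset V) (q : ℕ) (f : V → ℕ) :
    f ∈ gzCol G W q ↔ (∀ i, (i ∈ W → 1 ≤ f i ∧ f i ≤ q) ∧ (i ∉ W → f i = 0)) ∧
      ∀ i ∈ W, ∀ j ∈ W, G.Adj i j → f i ≠ f j := by
  classical
  unfold gzCol
  simp only [Finset.mem_filter, Fintype.mem_piFinset]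
  refine and_congr_left fun _ => forall_congr' fun i => ?_
  by_cases h : i ∈ W <;> simp [h]

/-- independent sets -/
def GzInd {V : Type} (G : SimpleGraph V) (S : Finset V) : Prop := ∀ i ∈ S, ∀ j ∈ S, ¬ G.Adj i j

/-- acyclic orientations of `G[W]` -/
def GzAO {V : Type} (G : SimpleGraph V) (W : Finset V) (r : V → V → Prop) : Prop :=
  (∀ i j, (r i j ∨ r j i) ↔ (G.Adj i j ∧ i ∈ W ∧ j ∈ W)) ∧ (∀ i j, ¬(r i j ∧ r j i)) ∧
    ∀ w, ¬ Relation.TransGen r w w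

open Classical in
lemma gz_fiber {V : Type} [Fintype V] (G : SimpleGraph V) (W S : Finset V) (hS : S ⊆ W) (q : ℕ) :
    ((gzCol G W (q+1)).filter (fun f => Finset.univ.filter (fun i => f i = q+1) = S)).card
      = if GzInd G S then (gzCol G (W \ S) q).card else 0 := by
  split_ifs with hI
  · refine Finset.card_bij' (fun f _ i => if i ∈ S then 0 else f i)
      (fun g _ i => if i ∈ S then q+1 else g i) ?_ ?_ ?_ ?_
    · intro f hf
      simp only [Finset.mem_filter, gz_mem_col] at hf ⊢
      obtain ⟨⟨h1, h2⟩, h3⟩ := hf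
      have h4 : ∀ i, f i = q+1 ↔ i ∈ S := fun i => by rw [← h3]; simp
      constructor
      · intro i
        have := h1 i; have := h4 i
        grind
      · intro i hi j hj hij
        have := h2 i; have := h4 i
        grind
    · intro f hf
      simp only [Finset.mem_filter, gz_mem_col] at hf ⊢
      obtain ⟨h1, h2⟩ := hf
      refine ⟨⟨?_, ?_⟩, ?_⟩
      · intro i
        have := h1 i; have := @hS i
        grind
      · intro i hi j hj hij
        have := h1 i; have := h1 j; have := h2 i; have := hI i
        grind
      · ext i
        have := h1 i; have := @hS i
        simp only [Finset.mem_filter, Finset.mem_univ, true_and]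
        grind
    · intro f hf
      simp only [Finset.mem_filter, gz_mem_col] at hf
      obtain ⟨⟨h1, h2⟩, h3⟩ := hf
      have h4 : ∀ i, f i = q+1 ↔ i ∈ S := fun i => by rw [← h3]; simp
      funext i
      have := h4 i
      grind
    · intro f hf
      simp only [gz_mem_col] at hf
      obtain ⟨h1, h2⟩ := hf
      funext i
      have := h1 i
      grind
  · rw [Finset.card_eq_zero, Finset.filter_eq_empty_iff]
    intro f hf h3
    apply hI
    have h4 : ∀ i, f i = q+1 ↔ i ∈ S := fun i => by rw [← h3]; simp
    rw [gz_mem_col] at hf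
    intro i hi j hj hij
    exact hf.2 i (hS hi) j (hS hj) hij (by rw [(h4 i).2 hi, (h4 j).2 hj])

open Classical in
lemma gz_col_succ {V : Type} [Fintype V] (G : SimpleGraph V) (W : Finset V) (q : ℕ) :
    (gzCol G W (q+1)).card = ∑ S ∈ W.powerset with GzInd G S, (gzCol G (W \ S) q).card := by
  rw [Finset.sum_filter, Finset.card_eq_sum_card_fiberwise
    (f := fun f => Finset.univ.filter (fun i => f i = q+1)) (t := W.powerset)]
  · refine Finset.sum_congr rfl fun S hS => ?_
    rw [← gz_fiber G W S (Finset.mem_powerset.1 hS)]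
  · intro f hf
    simp only [Finset.mem_coe, gz_mem_col] at hf
    simp only [Finset.mem_coe, Finset.mem_powerset]
    intro i hi
    simp only [Finset.mem_filter, Finset.mem_univ, true_and] at hi
    by_contra h
    have := (hf.1 i).2 h
    omega

open Classical in
lemma gz_col_succ_v {V : Type} [Fintype V] (G : SimpleGraph V) (W : Finset V) (v : V) (q : ℕ) :
    ((gzCol G W (q+1)).filter (fun f => f v = q+1)).card
      = ∑ S ∈ W.powerset with (GzInd G S ∧ v ∈ S), (gzCol G (W \ S) q).card := by
  have e : W.powerset.filter (fun S => GzInd G S ∧ v ∈ S)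
      = (W.powerset.filter (fun S => v ∈ S)).filter (fun S => GzInd G S) := by
    ext; simp only [Finset.mem_filter]; tauto
  rw [e, Finset.sum_filter, Finset.card_eq_sum_card_fiberwise
    (f := fun f => Finset.univ.filter (fun i => f i = q+1)) (t := W.powerset.filter (v ∈ ·))]
  · refine Finset.sum_congr rfl fun S hS => ?_
    rw [Finset.mem_filter] at hS
    rw [← gz_fiber G W S (Finset.mem_powerset.1 hS.1), Finset.filter_filter]
    congr 1
    refine Finset.filter_congr fun f _ => ⟨fun h => h.2, fun h => ⟨?_, h⟩⟩
    have := hS.2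
    rw [← h] at this
    simpa using this
  · intro f hf
    simp only [Finset.coe_filter, gz_mem_col, Set.mem_ofPred_eq] at hf
    simp only [Finset.mem_coe, Finset.mem_powerset, Finset.mem_filter]
    refine ⟨?_, by simpa using hf.2⟩
    intro i hi
    simp only [Finset.mem_filter, Finset.mem_univ, true_and] at hi
    by_contra h
    have := (hf.1.1 i).2 h
    omega

open Classical in
lemma gz_sym {V : Type} [Fintype V] (G : SimpleGraph V) (v : V) (q : ℕ) :
    (gzCol G Finset.univ (q+1)).card
      = (q+1) * ((gzCol G Finset.univ (q+1)).filter (fun f => f v = q+1)).card := by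
  rw [Finset.card_eq_sum_card_fiberwise (f := fun f : V → ℕ => f v) (t := Finset.Icc 1 (q+1))]
  · rw [Finset.sum_const_nat (m := ((gzCol G Finset.univ (q+1)).filter (fun f => f v = q+1)).card)]
    · simp
    · intro k hk
      rw [Finset.mem_Icc] at hk
      have hs : ∀ x, (1 ≤ x ∧ x ≤ q+1) → 1 ≤ Equiv.swap k (q+1) x ∧ Equiv.swap k (q+1) x ≤ q+1 := by
        intro x hx
        rw [Equiv.swap_apply_def]
        grind
      refine Finset.card_bij' (fun f _ i => Equiv.swap k (q+1) (f i))
        (fun f _ i => Equiv.swap k (q+1) (f i)) ?_ ?_ ?_ ?_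
      · intro f hf
        simp only [Finset.mem_filter, gz_mem_col, Finset.mem_univ, forall_const, not_true,
          false_imp_iff, and_true, true_imp_iff] at hf ⊢
        refine ⟨⟨fun i => hs _ (hf.1.1 i), fun i j hij h => hf.1.2 i j hij (by simpa using h)⟩, ?_⟩
        rw [hf.2]; simp
      · intro f hf
        simp only [Finset.mem_filter, gz_mem_col, Finset.mem_univ, forall_const, not_true,
          false_imp_iff, and_true, true_imp_iff] at hf ⊢
        refine ⟨⟨fun i => hs _ (hf.1.1 i), fun i j hij h => hf.1.2 i j hij (by simpa using h)⟩, ?_⟩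
        rw [hf.2]; simp
      · intro f hf; simp
      · intro f hf; simp
  · intro f hf
    simp only [Finset.mem_coe, gz_mem_col] at hf
    simpa using (hf.1 v).1 (Finset.mem_univ _)

lemma gz_col_zero {V : Type} [Fintype V] (G : SimpleGraph V) (W : Finset V) (hW : W.Nonempty) :
    (gzCol G W 0).card = 0 := by
  obtain ⟨i, hi⟩ := hW
  rw [Finset.card_eq_zero, Finset.eq_empty_iff_forall_notMem]
  intro f hf
  rw [gz_mem_col] at hf
  have := (hf.1 i).1 hi
  omega

lemma gz_col_empty {V : Type} [Fintype V] (G : SimpleGraph V) (q : ℕ) :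
    (gzCol G ∅ q).card = 1 := by
  rw [Finset.card_eq_one]
  refine ⟨fun _ => 0, ?_⟩
  ext f
  rw [gz_mem_col]
  simp [funext_iff]

/-- antidifferences -/
lemma gz_antidiff (p : Polynomial ℚ) : ∃ s : Polynomial ℚ, ∀ q : ℕ,
    s.eval (q : ℚ) = ∑ k ∈ Finset.range q, p.eval (k : ℚ) := by
  induction p using Polynomial.induction_on' with
  | add a b ha hb =>
    obtain ⟨s, hs⟩ := ha
    obtain ⟨t, ht⟩ := hb
    exact ⟨s + t, fun q => by simp [hs, ht, Finset.sum_add_distrib]⟩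
  | monomial n a =>
    refine ⟨Polynomial.C (a / (n+1)) *
      (Polynomial.bernoulli n.succ - Polynomial.C (bernoulli n.succ)), fun q => ?_⟩
    have h : (n:ℚ) + 1 ≠ 0 := by positivity
    simp only [Polynomial.eval_mul, Polynomial.eval_C, Polynomial.eval_sub,
      Polynomial.bernoulli_succ_eval, Polynomial.eval_monomial, ← Finset.mul_sum]
    field_simp
    ring

open Classical in
lemma gz_poly {V : Type} [Fintype V] (G : SimpleGraph V) (W : Finset V) :
    ∃ p : Polynomial ℚ, ∀ q : ℕ, p.eval (q : ℚ) = (gzCol G W q).card := by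
  induction W using Finset.strongInduction with
  | H W ih =>
    rcases W.eq_empty_or_nonempty with rfl | hW
    · exact ⟨1, fun q => by simp [gz_col_empty]⟩
    have : ∀ S : Finset V, ∃ p : Polynomial ℚ, S ≠ ∅ → S ⊆ W →
        ∀ q : ℕ, p.eval (q : ℚ) = (gzCol G (W \ S) q).card := by
      intro S
      by_cases h : S ≠ ∅ ∧ S ⊆ W
      · obtain ⟨p, hp⟩ := ih (W \ S) (Finset.sdiff_ssubset h.2 (Finset.nonempty_iff_ne_empty.2 h.1))
        exact ⟨p, fun _ _ => hp⟩
      · exact ⟨0, fun h1 h2 => absurd ⟨h1, h2⟩ h⟩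
    choose p hp using this
    obtain ⟨s, hs⟩ := gz_antidiff (∑ S ∈ (W.powerset.filter (GzInd G)).erase ∅, p S)
    refine ⟨s, fun q => ?_⟩
    rw [hs]
    induction q with
    | zero => simp [gz_col_zero G W hW]
    | succ q ihq =>
      rw [Finset.sum_range_succ, ihq, gz_col_succ,
        ← Finset.add_sum_erase (W.powerset.filter (GzInd G)) (fun S => (gzCol G (W \ S) q).card)
          (a := ∅)]
      · rw [Finset.sdiff_empty]
        push_cast
        congr 1
        rw [Polynomial.eval_finsetSum]
        refine Finset.sum_congr rfl fun S hS => ?_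
        simp only [Finset.mem_erase, Finset.mem_filter, Finset.mem_powerset] at hS
        exact hp S hS.1 hS.2.1 q
      · simp [GzInd]

/-- polynomial identity from values at the naturals -/
lemma gz_poly_ext (p r : Polynomial ℚ) (h : ∀ q : ℕ, p.eval (q : ℚ) = r.eval (q : ℚ)) : p = r := by
  refine Polynomial.eq_of_infinite_eval_eq p r ?_
  refine Set.Infinite.mono (s := Set.range (fun q : ℕ => (q : ℚ))) ?_
    (Set.infinite_range_of_injective Nat.cast_injective)
  rintro _ ⟨q, rfl⟩
  exact h q

open Classical in
/-- number of acyclic orientations of `G[W]` -/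
noncomputable def gzA {V : Type} [Fintype V] (G : SimpleGraph V) (W : Finset V) : ℕ :=
  (Finset.univ.filter (fun r : V → V → Prop => GzAO G W r)).card

lemma gz_no_cycle {V : Type} (r r' : V → V → Prop) (S : Finset V)
    (h : ∀ i j, r i j → i ∉ S) (h' : ∀ i j, r i j → j ∉ S → r' i j)
    (hac : ∀ w, ¬ Relation.TransGen r' w w) (w : V) : ¬ Relation.TransGen r w w := by
  intro hw
  have hwS : w ∉ S := by
    obtain ⟨b, hb, _⟩ := Relation.TransGen.head'_iff.1 hw
    exact h _ _ hb
  have key : ∀ a b, Relation.TransGen r a b → b ∉ S → Relation.TransGen r' a b := by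
    intro a b hab
    induction hab with
    | single h1 => exact fun hb => .single (h' _ _ h1 hb)
    | tail _ h2 ih => exact fun hb => .tail (ih (h _ _ h2)) (h' _ _ h2 hb)
  exact hac w (key w w hw hwS)

open Classical in
lemma gz_AO_sub {V : Type} [Fintype V] (G : SimpleGraph V) (W S : Finset V) (hS : S ⊆ W) :
    (Finset.univ.filter (fun r : V → V → Prop => GzAO G W r ∧ ∀ w ∈ S, IsSink r w)).card
      = if GzInd G S then gzA G (W \ S) else 0 := by
  split_ifs with hI
  · unfold gzA
    refine Finset.card_bij' (fun r _ i j => r i j ∧ j ∉ S)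
      (fun r _ i j => r i j ∨ (G.Adj i j ∧ i ∈ W ∧ i ∉ S ∧ j ∈ S)) ?_ ?_ ?_ ?_
    · intro r hr
      simp only [Finset.mem_filter, Finset.mem_univ, true_and] at hr ⊢
      obtain ⟨⟨h1, h2, h3⟩, h4⟩ := hr
      have h4' : ∀ i j, r i j → i ∉ S := fun i j hij hi => h4 i hi j hij
      refine ⟨?_, ?_, ?_⟩
      · intro i j
        have := h1 i j; have := h4' i j; have := h4' j i
        simp only [Finset.mem_sdiff]
        tauto
      · intro i j; have := h2 i j; tauto
      · intro w hw
        exact h3 w (hw.lift id (fun _ _ h => h.1))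
    · intro r hr
      simp only [Finset.mem_filter, Finset.mem_univ, true_and] at hr ⊢
      obtain ⟨h1, h2, h3⟩ := hr
      simp only [Finset.mem_sdiff] at h1
      refine ⟨⟨?_, ?_, ?_⟩, ?_⟩
      · intro i j
        have := h1 i j; have := @hS i; have := @hS j; have := hI i; have := G.adj_comm i j
        have := hI i
        by_cases hi : i ∈ S <;> by_cases hj : j ∈ S <;> grind
      · intro i j; have := h1 i j; have := h2 i j
        tauto
      · refine gz_no_cycle _ r S ?_ ?_ h3
        · intro i j; have := h1 i j; tauto
        · intro i j; tauto
      · intro w hw u; have := h1 w u; tauto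
    · intro r hr
      simp only [Finset.mem_filter, Finset.mem_univ, true_and] at hr
      obtain ⟨⟨h1, h2, h3⟩, h4⟩ := hr
      have h4' : ∀ i j, r i j → i ∉ S := fun i j hij hi => h4 i hi j hij
      funext i j
      have := h1 i j; have := h4' i j; have := h4' j i; have := @hS j
      apply propext
      tauto
    · intro r hr
      simp only [Finset.mem_filter, Finset.mem_univ, true_and] at hr
      obtain ⟨h1, h2, h3⟩ := hr
      simp only [Finset.mem_sdiff] at h1
      funext i j
      have := h1 i j
      apply propext
      tauto
  · rw [Finset.card_eq_zero, Finset.filter_eq_empty_iff]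
    rintro r - ⟨⟨h1, h2, h3⟩, h4⟩
    apply hI
    intro i hi j hj hij
    rcases (h1 i j).2 ⟨hij, hS hi, hS hj⟩ with h | h
    · exact h4 i hi j h
    · exact h4 j hj i h

lemma gz_exists_sink {V : Type} [Fintype V] (G : SimpleGraph V) (W : Finset V) (hW : W.Nonempty)
    (r : V → V → Prop) (hr : GzAO G W r) : ∃ w ∈ W, IsSink r w := by
  obtain ⟨h1, h2, h3⟩ := hr
  have wf : WellFounded (fun a b => Relation.TransGen r b a) := by
    have : IsTrans V (fun a b => Relation.TransGen r b a) := ⟨fun a b c h h' => h'.trans h⟩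
    have : Std.Irrefl (fun a b => Relation.TransGen r b a) := ⟨fun a h => h3 a h⟩
    exact Finite.wellFounded_of_trans_of_irrefl _
  obtain ⟨w, hw, hm⟩ := wf.has_min (W : Set V) hW
  refine ⟨w, hw, fun u hu => hm u ?_ (.single hu)⟩
  exact ((h1 w u).1 (Or.inl hu)).2.2

open Classical in
lemma gz_incl_excl {V : Type} [Fintype V] (G : SimpleGraph V) (W : Finset V) (hW : W.Nonempty) :
    ∑ S ∈ W.powerset with GzInd G S, (-1 : ℤ) ^ S.card * (gzA G (W \ S) : ℤ) = 0 := by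
  have : ∀ S ∈ W.powerset, (if GzInd G S then (-1 : ℤ) ^ S.card * (gzA G (W \ S) : ℤ) else 0)
      = ∑ r : V → V → Prop with GzAO G W r,
          if ∀ w ∈ S, IsSink r w then (-1 : ℤ) ^ S.card else 0 := by
    intro S hS
    have := gz_AO_sub G W S (Finset.mem_powerset.1 hS)
    rw [← Finset.sum_filter, Finset.filter_filter, Finset.sum_const, this]
    split_ifs <;> simp [mul_comm]
  rw [Finset.sum_filter, Finset.sum_congr rfl this, Finset.sum_comm]
  refine Finset.sum_eq_zero fun r hr => ?_
  rw [← Finset.sum_filter]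
  have e : W.powerset.filter (fun S => ∀ w ∈ S, IsSink r w)
      = (W.filter (IsSink r)).powerset := by
    ext S
    simp only [Finset.mem_filter, Finset.mem_powerset, Finset.subset_iff]
    grind
  rw [e, Finset.sum_powerset_neg_one_pow_card, if_neg]
  obtain ⟨w, hw, hs⟩ := gz_exists_sink G W hW r (by simpa using hr)
  exact Finset.ne_empty_of_mem (a := w) (by simp [hw, hs])

open Classical in
lemma gz_incl_excl_v {V : Type} [Fintype V] (G : SimpleGraph V) (v : V) :
    ∑ S ∈ (Finset.univ : Finset V).powerset with (GzInd G S ∧ v ∈ S),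
        (-1 : ℤ) ^ S.card * (gzA G (Finset.univ \ S) : ℤ)
      = - ((Finset.univ.filter (fun r : V → V → Prop =>
          GzAO G Finset.univ r ∧ ∀ w, IsSink r w ↔ w = v)).card : ℤ) := by
  have : ∀ S ∈ (Finset.univ : Finset V).powerset,
      (if GzInd G S ∧ v ∈ S then (-1 : ℤ) ^ S.card * (gzA G (Finset.univ \ S) : ℤ) else 0)
      = ∑ r : V → V → Prop with GzAO G Finset.univ r,
          if (∀ w ∈ S, IsSink r w) ∧ v ∈ S then (-1 : ℤ) ^ S.card else 0 := by
    intro S hS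
    have := gz_AO_sub G Finset.univ S (Finset.mem_powerset.1 hS)
    by_cases hv : v ∈ S
    · simp only [hv, and_true]
      rw [← Finset.sum_filter, Finset.filter_filter, Finset.sum_const, this]
      split_ifs <;> simp [mul_comm]
    · simp [hv]
  rw [Finset.sum_filter, Finset.sum_congr rfl this, Finset.sum_comm, ← Finset.filter_filter,
    Finset.card_filter]
  push_cast
  rw [← Finset.sum_neg_distrib]
  refine Finset.sum_congr rfl fun r hr => ?_
  rw [← Finset.sum_filter]
  by_cases hv : IsSink r v
  · have e : ∑ S ∈ (Finset.univ : Finset V).powerset with ((∀ w ∈ S, IsSink r w) ∧ v ∈ S),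
        (-1 : ℤ) ^ S.card
        = ∑ S ∈ ((Finset.univ.filter (IsSink r)).erase v).powerset, -(-1 : ℤ) ^ S.card := by
      refine Finset.sum_bij' (fun S _ => S.erase v) (fun S _ => insert v S) ?_ ?_ ?_ ?_ ?_
      · intro S hS
        simp only [Finset.mem_filter, Finset.mem_powerset, Finset.subset_iff, Finset.mem_erase,
          Finset.mem_univ, true_and] at hS ⊢
        grind
      · intro S hS
        simp only [Finset.mem_filter, Finset.mem_powerset, Finset.subset_iff, Finset.mem_erase,
          Finset.mem_univ, true_and, Finset.mem_insert] at hS ⊢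
        grind
      · intro S hS
        simp only [Finset.mem_filter] at hS
        exact Finset.insert_erase hS.2.2
      · intro S hS
        simp only [Finset.mem_powerset, Finset.subset_iff, Finset.mem_erase] at hS
        exact Finset.erase_insert (fun h => (hS h).1 rfl)
      · intro S hS
        simp only [Finset.mem_filter] at hS
        rw [← Finset.card_erase_add_one hS.2.2, pow_succ]
        ring
    rw [e, Finset.sum_neg_distrib, Finset.sum_powerset_neg_one_pow_card]
    congr 1
    refine if_congr ?_ rfl rfl
    simp only [Finset.eq_empty_iff_forall_notMem, Finset.mem_erase, Finset.mem_filter,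
      Finset.mem_univ, true_and]
    grind
  · rw [if_neg (fun h => hv ((h v).2 rfl)), neg_zero]
    refine Finset.sum_eq_zero fun S hS => ?_
    simp only [Finset.mem_filter] at hS
    exact absurd (hS.2.1 v hS.2.2) hv

lemma gz_A_empty {V : Type} [Fintype V] (G : SimpleGraph V) : gzA G ∅ = 1 := by
  classical
  unfold gzA
  rw [Finset.card_eq_one]
  refine ⟨fun _ _ => False, ?_⟩
  ext r
  simp only [Finset.mem_filter, Finset.mem_univ, true_and, Finset.mem_singleton]
  constructor
  · intro h
    funext i j
    have := h.1 i j
    simp at this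
    simp [this.1]
  · rintro rfl
    refine ⟨by simp, by simp, fun w hw => ?_⟩
    obtain ⟨b, hb, _⟩ := Relation.TransGen.head'_iff.1 hw
    exact hb

open Classical in
lemma gz_aux {V : Type} [Fintype V] (G : SimpleGraph V) (v : V) (P : Polynomial ℚ)
    (hP : ∀ q : ℕ, 0 < q → P.eval (q : ℚ) = (gzCol G Finset.univ q).card) :
    (((Finset.univ.filter (fun r : V → V → Prop =>
          GzAO G Finset.univ r ∧ ∀ w, IsSink r w ↔ w = v)).card : ℤ) : ℚ) =
      (-1) ^ (Fintype.card V - 1) * P.coeff 1 := by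
  choose p hp using gz_poly G
  have hrec : ∀ W : Finset V, (p W).comp (Polynomial.X + 1)
      = ∑ S ∈ W.powerset with GzInd G S, p (W \ S) := by
    intro W
    refine gz_poly_ext _ _ fun q => ?_
    rw [Polynomial.eval_finsetSum]
    simp only [hp, Polynomial.eval_comp, Polynomial.eval_add, Polynomial.eval_X,
      Polynomial.eval_one]
    have := hp W (q+1)
    push_cast at this
    rw [this, gz_col_succ]
    push_cast
    rfl
  have hA : ∀ W : Finset V, (p W).eval (-1) = (-1) ^ W.card * (gzA G W : ℚ) := by
    intro W
    induction W using Finset.strongInduction with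
    | H W ih =>
      rcases W.eq_empty_or_nonempty with rfl | hW
      · have : p ∅ = 1 := gz_poly_ext _ _ fun q => by simp [hp, gz_col_empty]
        simp [this, gz_A_empty]
      have h0 : ∅ ∈ W.powerset.filter (GzInd G) := by simp [GzInd]
      have h1 := congrArg (Polynomial.eval (-1)) (hrec W)
      have h2 := hp W 0
      rw [gz_col_zero G W hW] at h2
      simp only [Polynomial.eval_comp, Polynomial.eval_add, Polynomial.eval_X,
        Polynomial.eval_one, Polynomial.eval_finsetSum, neg_add_cancel] at h1
      rw [← Finset.add_sum_erase _ _ h0] at h1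
      have h3 := congrArg (fun z : ℤ => (z : ℚ)) (gz_incl_excl G W hW)
      rw [← Finset.add_sum_erase _ _ h0] at h3
      push_cast at h2 h3
      simp only [Finset.sdiff_empty, Finset.card_empty, pow_zero, one_mul] at h1 h3
      have h4 : ∑ S ∈ (W.powerset.filter (GzInd G)).erase ∅, (p (W \ S)).eval (-1)
        = (-1) ^ W.card * ∑ S ∈ (W.powerset.filter (GzInd G)).erase ∅,
            (-1 : ℚ) ^ S.card * (gzA G (W \ S) : ℚ) := by
        rw [Finset.mul_sum]
        refine Finset.sum_congr rfl fun S hS => ?_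
        simp only [Finset.mem_erase, Finset.mem_filter, Finset.mem_powerset] at hS
        rw [ih _ (Finset.sdiff_ssubset hS.2.1 (Finset.nonempty_iff_ne_empty.2 hS.1)),
          ← Finset.card_sdiff_add_card_eq_card hS.2.1, pow_add]
        have : ((-1 : ℚ) ^ S.card) * (-1) ^ S.card = 1 := by
          rw [← mul_pow]; simp
        linear_combination (-(-1 : ℚ) ^ (W \ S).card * (gzA G (W \ S) : ℚ)) * this
      rw [h4] at h1
      linear_combination -(-1 : ℚ) ^ W.card * h3 - h1 + h2
  set R : Polynomial ℚ := ∑ S ∈ (Finset.univ : Finset V).powerset with (GzInd G S ∧ v ∈ S),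
    p (Finset.univ \ S) with hR
  have hPR : P.comp (Polynomial.X + 1) = (Polynomial.X + 1) * R := by
    refine gz_poly_ext _ _ fun q => ?_
    rw [hR]
    simp only [hp, Polynomial.eval_comp, Polynomial.eval_add, Polynomial.eval_X,
      Polynomial.eval_one, Polynomial.eval_mul, Polynomial.eval_finsetSum]
    have := hP (q+1) (Nat.succ_pos q)
    push_cast at this
    rw [this, gz_sym G v, gz_col_succ_v]
    push_cast
    rfl
  have hPR' : P = Polynomial.X * R.comp (Polynomial.X - 1) := by
    have := congrArg (fun s : Polynomial ℚ => s.comp (Polynomial.X - 1)) hPR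
    simpa [Polynomial.comp_assoc] using this
  have hc : P.coeff 1 = R.eval (-1) := by
    rw [hPR', Polynomial.coeff_X_mul, Polynomial.coeff_zero_eq_eval_zero]
    simp
  have hn : 1 ≤ Fintype.card V := Fintype.card_pos_iff.2 ⟨v⟩
  have h3 := congrArg (fun z : ℤ => (z : ℚ)) (gz_incl_excl_v G v)
  push_cast at h3
  have h4 : R.eval (-1) = (-1) ^ Fintype.card V *
      ∑ S ∈ (Finset.univ : Finset V).powerset with (GzInd G S ∧ v ∈ S),
        (-1 : ℚ) ^ S.card * (gzA G (Finset.univ \ S) : ℚ) := by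
    rw [hR, Polynomial.eval_finsetSum, Finset.mul_sum]
    refine Finset.sum_congr rfl fun S hS => ?_
    rw [hA, ← Finset.card_univ, ← Finset.card_sdiff_add_card_eq_card (Finset.subset_univ S),
      pow_add]
    have : ((-1 : ℚ) ^ S.card) * (-1) ^ S.card = 1 := by
      rw [← mul_pow]; simp
    linear_combination
      (-(-1 : ℚ) ^ (Finset.univ \ S).card * (gzA G (Finset.univ \ S) : ℚ)) * this
  rw [hc, h4, h3]
  obtain ⟨m, hm⟩ := Nat.exists_eq_add_of_le' hn
  rw [hm, Nat.add_sub_cancel, pow_succ]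
  have : ((-1 : ℚ) ^ m) * (-1) ^ m = 1 := by
    rw [← mul_pow]; simp
  push_cast
  linear_combination (-((Finset.univ.filter (fun r : V → V → Prop =>
          GzAO G Finset.univ r ∧ ∀ w, IsSink r w ↔ w = v)).card : ℚ)) * this

lemma gz_count {V : Type} [Fintype V] (G : SimpleGraph V) (q : ℕ) :
    Set.ncard {f : V → Fin q | ∀ i j, G.Adj i j → f i ≠ f j} = (gzCol G Finset.univ q).card := by
  rw [← Set.ncard_coe_finset]
  refine Set.ncard_congr (fun f _ i => (f i : ℕ) + 1) ?_ ?_ ?_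
  · intro f hf
    simp only [Finset.mem_coe, gz_mem_col]
    refine ⟨fun i => ⟨fun _ => ⟨by omega, by have := (f i).2; omega⟩,
      fun h => absurd (Finset.mem_univ i) h⟩, fun i _ j _ hij h => hf i j hij ?_⟩
    exact Fin.ext (by omega)
  · intro f g _ _ h
    funext i
    have := congrFun h i
    exact Fin.ext (by simpa using this)
  · intro g hg
    simp only [Finset.mem_coe, gz_mem_col] at hg
    have hb : ∀ i, 1 ≤ g i ∧ g i ≤ q := fun i => (hg.1 i).1 (Finset.mem_univ i)
    refine ⟨fun i => ⟨g i - 1, by have := hb i; omega⟩, ?_, ?_⟩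
    · intro i j hij h
      refine hg.2 i (Finset.mem_univ i) j (Finset.mem_univ j) hij ?_
      have h := congrArg Fin.val h
      simp only [] at h
      have := hb i; have := hb j
      omega
    · funext i
      have := hb i
      simp only []
      omega

/-- Greene–Zaslavsky: for a connected simple graph `G` on `n ≥ 1`
vertices with chromatic polynomial `P` and a vertex `v`, the number of acyclic
orientations of `G` whose unique sink is `v` equals `(-1)^{n-1}` times the
coefficient of `t¹` in `P`. -/
theorem greene_zaslavsky (V : Type) [Fintype V] [DecidableEq V]
    (G : SimpleGraph V) (hconn : G.Connected) (hcard : 1 ≤ Fintype.card V) (v : V)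
    (P : Polynomial ℚ)
    (hchrom : ∀ q : ℕ, 0 < q →
      P.eval (q : ℚ) =
        Set.ncard {f : V → Fin q | ∀ i j, G.Adj i j → f i ≠ f j}) :
    (Set.ncard {r : V → V → Prop |
        IsOrientation G r ∧ IsAcyclicOrientation r ∧
        ∀ w, IsSink r w ↔ w = v} : ℚ) =
      (-1) ^ (Fintype.card V - 1) * P.coeff 1 := by
  classical
  have h := gz_aux G v P (fun q hq => by rw [hchrom q hq, gz_count])
  rw [← h, Int.cast_natCast, ← Set.ncard_coe_finset]
  congr 2
  ext r
  simp only [Set.mem_ofPred_eq, Finset.coe_filter, Finset.mem_univ, true_and, and_true, GzAO,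
    IsOrientation, IsAcyclicOrientation, and_assoc]
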